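/- With rotation systems of K₅, face permutation, and the action of Aut(K₅) × C₂ (relabeling by permutations of Fin 5 together with reversal of all rotations) defined as follows, the number of orbits of rotation systems of K₅ whose face permutation has exactly 1 orbit (one face) is exactly 13. -/

import Mathlib

/-- A rotation system of `K₅` assigns to each vertex a permutation of `Fin 5`. -/
abbrev K5RotSys := Fin 5 → Equiv.Perm (Fin 5)

/-- Each rotation fixes its vertex and is a single 4-cycle on the 4 neighbors. -/
def IsRotSysK5 (ρ : K5RotSys) : Prop :=
  ∀ y : Fin 5, (ρ y).IsCycle ∧ ρ y y = y ∧ (ρ y).support.card = 4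

/-- The face permutation on darts: `Φ (x, y) = (y, ρ_y x)`. -/
def facePermK5 (ρ : K5RotSys) : Fin 5 × Fin 5 → Fin 5 × Fin 5 :=
  fun d => (d.2, ρ d.2 d.1)

/-- Two darts lie on the same face. -/
def SameFace (ρ : K5RotSys) (d d' : Fin 5 × Fin 5) : Prop :=
  ∃ k : ℕ, (facePermK5 ρ)^[k] d = d'

/-- The face permutation has exactly `n` orbits on the 20 darts. -/
def HasFaces (ρ : K5RotSys) (n : ℕ) : Prop :=
  ∃ D : Fin n → Fin 5 × Fin 5,
    (∀ i, (D i).1 ≠ (D i).2) ∧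
    (∀ i j, i ≠ j → ¬ SameFace ρ (D i) (D j)) ∧
    ∀ d : Fin 5 × Fin 5, d.1 ≠ d.2 → ∃ i, SameFace ρ (D i) d

/-- Equivalence under `Aut(K₅) × C₂`: relabelling by a permutation `φ` of the
vertices, optionally composed with reversal of all rotations. -/
def EquivFullK5 (ρ ρ' : K5RotSys) : Prop :=
  ∃ φ : Equiv.Perm (Fin 5), ∃ r : Bool,
    ∀ y, ρ' (φ y) = φ * (if r then (ρ y)⁻¹ else ρ y) * φ⁻¹

/-- Equivalence under `Aut(K₅)` alone: relabelling by a permutation of the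
vertices. -/
def EquivAutK5 (ρ ρ' : K5RotSys) : Prop :=
  ∃ φ : Equiv.Perm (Fin 5), ∀ y, ρ' (φ y) = φ * ρ y * φ⁻¹

/-- The 4-cycle `(y+1, y+u, y+v, y+w)`, where `(u, v, w)` is the `k`-th permutation of `(2, 3, 4)`
in lexicographic order. -/
def rotK5 (y : Fin 5) (k : Fin 6) : Equiv.Perm (Fin 5) :=
  let u : Fin 5 := y + ![2, 2, 3, 3, 4, 4] k
  let v : Fin 5 := y + ![3, 4, 2, 4, 2, 3] k
  let w : Fin 5 := y + ![4, 3, 4, 2, 3, 2] k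
  Equiv.swap (y + 1) u * Equiv.swap u v * Equiv.swap v w

/-- Representatives of the one-face rotation systems. -/
def oneFaceRep (i : Fin 13) : K5RotSys := fun y => rotK5 y <| ![
    ![0, 0, 0, 0, 1],
    ![0, 0, 0, 4, 1],
    ![0, 0, 0, 4, 2],
    ![0, 0, 0, 4, 5],
    ![0, 0, 0, 1, 1],
    ![0, 0, 0, 2, 5],
    ![0, 0, 3, 0, 2],
    ![0, 0, 3, 4, 5],
    ![0, 0, 3, 3, 5],
    ![0, 0, 3, 5, 2],
    ![0, 0, 4, 4, 2],
    ![0, 2, 0, 4, 5],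
    ![0, 2, 4, 0, 3]] i y

/-! ### Rotation systems -/

theorem isRotSysK5_rotK5 (k : Fin 5 → Fin 6) : IsRotSysK5 fun y => rotK5 y (k y) := by
  have hfix : ∀ (y : Fin 5) (k : Fin 6), rotK5 y k y = y ∧ (rotK5 y k).support.card = 4 := by
    decide +kernel
  have hreach : ∀ (y : Fin 5) (k : Fin 6), rotK5 y k (y + 1) ≠ y + 1 ∧
      ∀ x, rotK5 y k x ≠ x → ∃ n : Fin 4, (rotK5 y k ^ (n : ℕ)) (y + 1) = x := by
    decide +kernel
  refine fun y => ⟨⟨y + 1, (hreach y _).1, fun x hx => ?_⟩, hfix y _⟩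
  obtain ⟨n, hn⟩ := (hreach y _).2 x hx
  exact ⟨n, by simpa using hn⟩

theorem IsRotSysK5.exists_rotK5 {ρ : K5RotSys} (h : IsRotSysK5 ρ) :
    ∃ k : Fin 5 → Fin 6, ρ = fun y => rotK5 y (k y) := by
  have key : ∀ (y : Fin 5) (p : Equiv.Perm (Fin 5)), p y = y → p.support.card = 4 → p ^ 2 ≠ 1 →
      ∃ k, p = rotK5 y k := by
    decide +kernel
  have hk (y : Fin 5) : ∃ k, ρ y = rotK5 y k := by
    obtain ⟨hc, hy, hs⟩ := h y
    refine key y _ hy hs fun h2 => ?_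
    have := orderOf_dvd_of_pow_eq_one h2
    rw [hc.orderOf, hs] at this
    omega
  choose k hk using hk
  exact ⟨k, funext hk⟩

theorem EquivFullK5.symm {ρ ρ' : K5RotSys} (h : EquivFullK5 ρ ρ') : EquivFullK5 ρ' ρ := by
  obtain ⟨φ, r, h⟩ := h
  refine ⟨φ⁻¹, r, fun y => ?_⟩
  have hy := h (φ⁻¹ y)
  rw [show φ (φ⁻¹ y) = y by simp] at hy
  cases r <;> simp [hy, mul_assoc]

theorem EquivFullK5.trans {ρ ρ' ρ'' : K5RotSys} (h : EquivFullK5 ρ ρ') (h' : EquivFullK5 ρ' ρ'') :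
    EquivFullK5 ρ ρ'' := by
  obtain ⟨φ, r, h⟩ := h
  obtain ⟨ψ, s, h'⟩ := h'
  refine ⟨ψ * φ, xor r s, fun y => ?_⟩
  have hy := h' (φ y)
  rw [h y] at hy
  cases r <;> cases s <;> simp_all [mul_assoc]

theorem EquivFullK5.isRotSysK5 {ρ ρ' : K5RotSys} (h : EquivFullK5 ρ ρ') (hρ : IsRotSysK5 ρ) :
    IsRotSysK5 ρ' := by
  obtain ⟨φ, r, h⟩ := h
  intro y
  obtain ⟨hc, hy, hs⟩ := hρ (φ⁻¹ y)
  have hy' := h (φ⁻¹ y)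
  rw [show φ (φ⁻¹ y) = y by simp] at hy'
  have hinv : (ρ (φ⁻¹ y))⁻¹ (φ⁻¹ y) = φ⁻¹ y := by rw [Equiv.Perm.inv_eq_iff_eq, hy]
  rw [hy']
  cases r
  · exact ⟨hc.conj, by simp_all, by simp_all⟩
  · exact ⟨hc.inv.conj, by simp_all, by simp_all⟩

/-! ### Faces -/

theorem facePermK5_injective (ρ : K5RotSys) : Function.Injective (facePermK5 ρ) := by
  rintro ⟨x, y⟩ ⟨x', y'⟩ h
  simp only [facePermK5, Prod.mk.injEq] at h
  obtain ⟨rfl, h⟩ := h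
  simpa using h

theorem HasFaces.iterate_ne {ρ : K5RotSys} (h : HasFaces ρ 1) {n : ℕ} (hn : 0 < n) (hn' : n < 20)
    {d : Fin 5 × Fin 5} (hd : d.1 ≠ d.2) : (facePermK5 ρ)^[n] d ≠ d := by
  obtain ⟨D, -, -, hD⟩ := h
  have hreach (d : Fin 5 × Fin 5) (hd : d.1 ≠ d.2) : ∃ k, (facePermK5 ρ)^[k] (D 0) = d := by
    obtain ⟨i, hi⟩ := hD d hd
    rwa [Subsingleton.elim i 0] at hi
  have hper : D 0 ∈ Function.periodicPts (facePermK5 ρ) :=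
    (facePermK5_injective ρ).mem_periodicPts _
  have hle : 20 ≤ Function.minimalPeriod (facePermK5 ρ) (D 0) := by
    have hsub : (Finset.univ.filter fun d : Fin 5 × Fin 5 => d.1 ≠ d.2) ⊆
        (Finset.range (Function.minimalPeriod (facePermK5 ρ) (D 0))).image
          fun k => (facePermK5 ρ)^[k] (D 0) := by
      intro d hd
      obtain ⟨k, rfl⟩ := hreach d (by simpa using hd)
      refine Finset.mem_image.2 ⟨k % Function.minimalPeriod (facePermK5 ρ) (D 0), ?_,
        Function.iterate_mod_minimalPeriod_eq⟩
      exact Finset.mem_range.2 (Nat.mod_lt _ (Function.minimalPeriod_pos_of_mem_periodicPts hper))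
    have hcard : (Finset.univ.filter fun d : Fin 5 × Fin 5 => d.1 ≠ d.2).card = 20 := by
      decide +kernel
    simpa [hcard] using (Finset.card_le_card hsub).trans Finset.card_image_le
  obtain ⟨k, rfl⟩ := hreach d hd
  exact Function.not_isPeriodicPt_of_pos_of_lt_minimalPeriod hn.ne'
    (by rw [Function.minimalPeriod_apply_iterate hper]; omega)

theorem hasFaces_one_of_forall {ρ : K5RotSys} {d₀ : Fin 5 × Fin 5} (hd₀ : d₀.1 ≠ d₀.2)
    (h : ∀ d : Fin 5 × Fin 5, d.1 ≠ d.2 → SameFace ρ d₀ d) : HasFaces ρ 1 :=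
  ⟨fun _ => d₀, fun _ => hd₀, fun i j hij => (hij (Subsingleton.elim i j)).elim,
    fun d hd => ⟨0, h d hd⟩⟩

theorem hasFaces_oneFaceRep (i : Fin 13) : HasFaces (oneFaceRep i) 1 := by
  have key : ∀ i : Fin 13, ∀ d : Fin 5 × Fin 5, d.1 ≠ d.2 →
      ∃ k : Fin 20, (facePermK5 (oneFaceRep i))^[k] (0, 1) = d := by
    decide +kernel
  refine hasFaces_one_of_forall (d₀ := (0, 1)) (by decide) fun d hd => ?_
  obtain ⟨k, hk⟩ := key i d hd
  exact ⟨k, hk⟩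

/-! ### Octal tables -/

/-- The octal digit of `t` at position `x`. -/
def octDigit (t x : ℕ) : ℕ := t / 8 ^ x % 8

/-- The octal numeral whose digits are the values of `p`. -/
def permTable (p : Equiv.Perm (Fin 5)) : ℕ :=
  p 0 + 8 * p 1 + 64 * p 2 + 512 * p 3 + 4096 * p 4

/-- The octal numeral in which the digits of each `t i` fill a block of length 5. -/
def concatTables (t₀ t₁ t₂ t₃ t₄ : ℕ) : ℕ :=
  t₀ + 8 ^ 5 * (t₁ + 8 ^ 5 * (t₂ + 8 ^ 5 * (t₃ + 8 ^ 5 * t₄)))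

theorem octDigit_permTable (p : Equiv.Perm (Fin 5)) (x : Fin 5) :
    octDigit (permTable p) x = p x := by
  fin_cases x <;> simp [octDigit, permTable] <;> omega

theorem permTable_lt (p : Equiv.Perm (Fin 5)) : permTable p < 8 ^ 5 := by
  simp only [permTable]
  omega

theorem octDigit_add_of_lt {a x : ℕ} (b : ℕ) (hx : x < 5) :
    octDigit (a + 8 ^ 5 * b) x = octDigit a x := by
  unfold octDigit
  interval_cases x <;> norm_num <;> omega

theorem octDigit_add_add_five {a : ℕ} (b x : ℕ) (ha : a < 8 ^ 5) :
    octDigit (a + 8 ^ 5 * b) (x + 5) = octDigit b x := by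
  unfold octDigit
  rw [add_comm x, pow_add, ← Nat.div_div_eq_div_mul, Nat.add_mul_div_left _ _ (by norm_num),
    Nat.div_eq_of_lt ha, zero_add]

/-- The octal numeral listing the rotations of `ρ`. -/
def rotSysTable (ρ : K5RotSys) : ℕ :=
  concatTables (permTable (ρ 0)) (permTable (ρ 1)) (permTable (ρ 2)) (permTable (ρ 3))
    (permTable (ρ 4))

theorem octDigit_rotSysTable (ρ : K5RotSys) (x y : Fin 5) :
    octDigit (rotSysTable ρ) (x + 5 * y) = ρ y x := by
  have hx := x.isLt
  have hpos : (x : ℕ) + 5 * y = ![(x : ℕ), x + 5, x + 5 + 5, x + 5 + 5 + 5, x + 5 + 5 + 5 + 5] y := by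
    fin_cases y <;> rfl
  rw [hpos]
  fin_cases y <;>
    simp only [rotSysTable, concatTables, octDigit_add_of_lt, octDigit_add_add_five, permTable_lt,
      octDigit_permTable, hx, Matrix.cons_val, Fin.zero_eta, Fin.mk_one, Fin.reduceFinMk]

/-! ### Codes of rotation systems -/

/-- An octal digit determining a 4-cycle that fixes `y` and whose values are given by `q`. -/
def cycleDigit (y : ℕ) (q : ℕ → ℕ) : ℕ :=
  let a := q ((y + 1) % 5)
  3 * ((a + 5 - y) % 5) + (q a + 5 - y) % 5 - 8

/-- The contribution of the rotation `p` at `y` to the code of a rotation system. -/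
def vertexCode (y : Fin 5) (p : Equiv.Perm (Fin 5)) : ℕ :=
  cycleDigit y (octDigit (permTable p)) * 8 ^ (y : ℕ)

/-- A number that determines the rotation system `ρ`. -/
def rotSysCode (ρ : K5RotSys) : ℕ :=
  vertexCode 0 (ρ 0) + vertexCode 1 (ρ 1) + vertexCode 2 (ρ 2) + vertexCode 3 (ρ 3) +
    vertexCode 4 (ρ 4)

theorem rotSysCode_injOn {ρ ρ' : K5RotSys} (h : IsRotSysK5 ρ) (h' : IsRotSysK5 ρ')
    (hcode : rotSysCode ρ = rotSysCode ρ') : ρ = ρ' := by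
  obtain ⟨k, rfl⟩ := h.exists_rotK5
  obtain ⟨k', rfl⟩ := h'.exists_rotK5
  have hdigit : ∀ (y : Fin 5) (k : Fin 6),
      cycleDigit y (octDigit (permTable (rotK5 y k))) = ![1, 2, 3, 5, 6, 7] k := by
    decide +kernel
  have hlt : ∀ k : Fin 6, (![1, 2, 3, 5, 6, 7] k : ℕ) < 8 := by decide
  have hinj : ∀ k k' : Fin 6, (![1, 2, 3, 5, 6, 7] k : ℕ) = ![1, 2, 3, 5, 6, 7] k' → k = k' := by
    decide
  simp only [rotSysCode, vertexCode, hdigit] at hcode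
  generalize hd : (![1, 2, 3, 5, 6, 7] : Fin 6 → ℕ) = digit at hcode hlt hinj
  norm_num at hcode
  have := hlt (k 0); have := hlt (k 1); have := hlt (k 2); have := hlt (k 3); have := hlt (k 4)
  have := hlt (k' 0); have := hlt (k' 1); have := hlt (k' 2); have := hlt (k' 3)
  have := hlt (k' 4)
  have hk : k = k' := by
    funext y
    apply hinj
    fin_cases y <;> simp only [Fin.isValue, Fin.zero_eta, Fin.mk_one, Fin.reduceFinMk] <;> omega
  rw [hk]

/-- The bit mask `2 ^ c`, where `c` is the code of the system obtained from `ρ` by the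
relabelling `φ`. -/
def relabelBit (φ : Equiv.Perm (Fin 5)) (ρ : K5RotSys) : ℕ :=
  let f := octDigit (permTable φ)
  let g := octDigit (permTable φ⁻¹)
  let c : Fin 5 → ℕ := fun y =>
    cycleDigit (f y) (fun x => f (octDigit (permTable (ρ y)) (g x))) * 8 ^ f y
  2 ^ (c 0 + c 1 + c 2 + c 3 + c 4)

theorem cycleDigit_eq (y : Fin 5) (p : Equiv.Perm (Fin 5)) {q : ℕ → ℕ}
    (hq : ∀ x : Fin 5, q x = p x) :
    cycleDigit y q = cycleDigit y (octDigit (permTable p)) := by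
  have hy : ((y : ℕ) + 1) % 5 = (y + 1 : Fin 5) := by simp [Fin.val_add]
  simp only [cycleDigit, hy, hq, octDigit_permTable]

theorem relabelBit_eq {φ : Equiv.Perm (Fin 5)} {ρ ρ' : K5RotSys}
    (h : ∀ y, ρ' (φ y) = φ * ρ y * φ⁻¹) : relabelBit φ ρ = 2 ^ rotSysCode ρ' := by
  have hterm (y : Fin 5) : cycleDigit (octDigit (permTable φ) y) (fun x => octDigit (permTable φ)
      (octDigit (permTable (ρ y)) (octDigit (permTable φ⁻¹) x))) * 8 ^ octDigit (permTable φ) y =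
      vertexCode (φ y) (ρ' (φ y)) := by
    rw [octDigit_permTable, vertexCode, cycleDigit_eq (φ y) (ρ' (φ y))]
    intro x
    simp only [octDigit_permTable, h, Equiv.Perm.mul_apply]
  have hsum := Equiv.sum_comp φ fun y => vertexCode y (ρ' y)
  simp only [Fin.sum_univ_five] at hsum
  simp only [relabelBit, hterm, hsum, rotSysCode]

/-! ### Bit masks -/

/-- Bitwise union of the masks `f a` for `a` in `l`. -/
def bitUnion {α : Type*} (l : List α) (f : α → ℕ) : ℕ :=
  l.foldr (fun a m => f a ||| m) 0

theorem testBit_bitUnion {α : Type*} {l : List α} {f : α → ℕ} {c : ℕ} :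
    (bitUnion l f).testBit c = true ↔ ∃ a ∈ l, (f a).testBit c = true := by
  induction l with
  | nil => simp [bitUnion]
  | cons a l ih =>
    change (f a ||| bitUnion l f).testBit c = true ↔ _
    simp [Nat.testBit_or, ih]

/-- The set of codes of the rotation systems equivalent to `ρ`. -/
def orbitMask (ρ : K5RotSys) : ℕ :=
  bitUnion [false, true] fun r => bitUnion (permsOfList [0, 1, 2, 3, 4]) fun φ =>
    relabelBit φ fun y => if r then (ρ y)⁻¹ else ρ y

theorem testBit_orbitMask {ρ : K5RotSys} {c : ℕ} :
    (orbitMask ρ).testBit c = true ↔ ∃ ρ', EquivFullK5 ρ ρ' ∧ rotSysCode ρ' = c := by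
  simp only [orbitMask, testBit_bitUnion]
  constructor
  · rintro ⟨r, -, φ, -, h⟩
    let ρ' : K5RotSys := fun z => φ * (if r then (ρ (φ⁻¹ z))⁻¹ else ρ (φ⁻¹ z)) * φ⁻¹
    have hρ' (y : Fin 5) : ρ' (φ y) = φ * (if r then (ρ y)⁻¹ else ρ y) * φ⁻¹ := by
      simp [ρ']
    refine ⟨ρ', ⟨φ, r, hρ'⟩, ?_⟩
    rwa [relabelBit_eq hρ', Nat.testBit_two_pow, decide_eq_true_eq] at h
  · rintro ⟨ρ', ⟨φ, r, h⟩, rfl⟩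
    refine ⟨r, by simp, φ, mem_permsOfList_of_mem fun x _ => ?_, ?_⟩
    · fin_cases x <;> simp
    · rw [relabelBit_eq h, Nat.testBit_two_pow_self]

/-- The walk with table `t` from the dart `(x, y)` does not meet `(0, 1)` in its first `n` darts. -/
def walkAvoids (t : ℕ) : ℕ → ℕ → ℕ → Bool
  | 0, _, _ => true
  | n + 1, x, y => !(Nat.beq (x + 5 * y) 5) && walkAvoids t n y (octDigit t (x + 5 * y))

theorem walkAvoids_rotSysTable {ρ : K5RotSys} {n : ℕ} {x y : Fin 5}
    (h : ∀ m < n, (facePermK5 ρ)^[m] (x, y) ≠ (0, 1)) :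
    walkAvoids (rotSysTable ρ) n x y = true := by
  induction n generalizing x y with
  | zero => rfl
  | succ n ih =>
    have h0 : (x, y) ≠ (0, 1) := h 0 n.succ_pos
    have hne : Nat.beq (x + 5 * y) 5 = false :=
      (by decide : ∀ x y : Fin 5, (x, y) ≠ (0, 1) → Nat.beq (x + 5 * y) 5 = false) x y h0
    rw [walkAvoids, octDigit_rotSysTable, hne, ih fun m hm => h (m + 1) (by omega)]
    rfl

/-- The set of codes of rotation systems for which the face of `(0, 1)` has length at least 20. -/
def longFaceMask : ℕ :=
  let l := [0, 1, 2, 3, 4, 5]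
  bitUnion l fun a => bitUnion l fun b => bitUnion l fun c => bitUnion l fun d => bitUnion l fun e =>
    let t := concatTables (permTable (rotK5 0 a)) (permTable (rotK5 1 b)) (permTable (rotK5 2 c))
      (permTable (rotK5 3 d)) (permTable (rotK5 4 e))
    if walkAvoids t 19 1 (octDigit t 5) then
      2 ^ (vertexCode 0 (rotK5 0 a) + vertexCode 1 (rotK5 1 b) + vertexCode 2 (rotK5 2 c) +
        vertexCode 3 (rotK5 3 d) + vertexCode 4 (rotK5 4 e))
    else 0

theorem testBit_longFaceMask {ρ : K5RotSys} (hρ : IsRotSysK5 ρ) (h : HasFaces ρ 1) :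
    longFaceMask.testBit (rotSysCode ρ) = true := by
  obtain ⟨k, rfl⟩ := hρ.exists_rotK5
  set ρ : K5RotSys := fun y => rotK5 y (k y)
  have hmem : ∀ a : Fin 6, a ∈ [0, 1, 2, 3, 4, 5] := by decide
  have hwalk : walkAvoids (rotSysTable ρ) 19 1 (octDigit (rotSysTable ρ) 5) = true := by
    have h5 : octDigit (rotSysTable ρ) 5 = ρ 1 0 := octDigit_rotSysTable ρ 0 1
    rw [h5]
    exact walkAvoids_rotSysTable (x := 1) fun m hm =>
      h.iterate_ne (n := m + 1) (d := (0, 1)) m.succ_pos (by omega) (by decide)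
  simp only [longFaceMask, testBit_bitUnion]
  refine ⟨k 0, hmem _, k 1, hmem _, k 2, hmem _, k 3, hmem _, k 4, hmem _, ?_⟩
  refine (congrArg (Nat.testBit · _) (if_pos hwalk)).trans ?_
  exact Nat.testBit_two_pow_self

theorem longFaceMask_eq :
    longFaceMask = bitUnion (List.finRange 13) fun i => orbitMask (oneFaceRep i) := by
  decide +kernel

theorem orbitMask_oneFaceRep_inter (i : Fin 13) :
    orbitMask (oneFaceRep i) &&&
      (bitUnion (List.finRange 13) fun j => 2 ^ rotSysCode (oneFaceRep j)) =
    2 ^ rotSysCode (oneFaceRep i) := by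
  revert i
  decide +kernel

theorem oneFaceRep_eq_of_equivFullK5 {i j : Fin 13}
    (h : EquivFullK5 (oneFaceRep i) (oneFaceRep j)) : i = j := by
  have hcode : ∀ i j : Fin 13,
      rotSysCode (oneFaceRep i) = rotSysCode (oneFaceRep j) → i = j := by
    decide +kernel
  refine hcode i j ?_
  have hi : (orbitMask (oneFaceRep i)).testBit (rotSysCode (oneFaceRep j)) = true :=
    testBit_orbitMask.2 ⟨_, h, rfl⟩
  have hj : (bitUnion (List.finRange 13) fun j => 2 ^ rotSysCode (oneFaceRep j)).testBit
      (rotSysCode (oneFaceRep j)) = true :=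
    testBit_bitUnion.2 ⟨j, List.mem_finRange j, Nat.testBit_two_pow_self⟩
  have hij := congrArg (Nat.testBit · (rotSysCode (oneFaceRep j))) (orbitMask_oneFaceRep_inter i)
  simpa [Nat.testBit_and, hi, hj, Nat.testBit_two_pow] using hij.symm

/-- Rotation systems of `K₅` with exactly one face (2-cell embeddings of `K₅` on
the triple torus) fall into exactly 13 orbits under `Aut(K₅) × C₂`. -/
theorem K5_triple_torus_embeddings :
    ∃ reps : Fin 13 → K5RotSys,
      (∀ i, IsRotSysK5 (reps i) ∧ HasFaces (reps i) 1) ∧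
      ∀ ρ, IsRotSysK5 ρ → HasFaces ρ 1 → ∃! i, EquivFullK5 (reps i) ρ := by
  refine ⟨oneFaceRep, fun i => ⟨isRotSysK5_rotK5 _, hasFaces_oneFaceRep i⟩, fun ρ hρ h => ?_⟩
  have hbit := testBit_longFaceMask hρ h
  rw [longFaceMask_eq, testBit_bitUnion] at hbit
  obtain ⟨i, -, hi⟩ := hbit
  obtain ⟨ρ', hequiv, hcode⟩ := testBit_orbitMask.1 hi
  have hρ' : ρ' = ρ :=
    rotSysCode_injOn (hequiv.isRotSysK5 (isRotSysK5_rotK5 _)) hρ hcode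
  subst hρ'
  exact ⟨i, hequiv, fun j hj => oneFaceRep_eq_of_equivFullK5 (hj.trans hequiv.symm)⟩
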